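/- Let A be a prime right noetherian ring, let L be an essential submodule of a finitely generated right A-module M, and suppose Ext^2_A(M/L, A) = 0. Then every extension 0 → A → X → L → 0 with X torsionfree lifts to an extension 0 → A → Y → M → 0, and every such Y is torsionfree. -/

import Mathlib

/- STATEMENT 2:
Let `A` be a prime right noetherian ring, let `L` be an essential submodule of a finitely
generated right `A`-module `M`, and suppose `Ext^2_A(M/L, A) = 0`. Then every extension
`0 → A → X → L → 0` with `X` torsionfree lifts to an extension `0 → A → Y → M → 0`
(i.e. there is an extension `Y` of `M` by `A` restricting to `X` over `L ⊆ M`), and every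
such `Y` is torsionfree.

Right `A`-modules are modules over `Aᵐᵒᵖ`; the right regular module is `Aᵐᵒᵖ`. -/

open CategoryTheory

def IsPrimeRing (A : Type) [Ring A] : Prop :=
  ∀ a b : A, (∀ x : A, a * x * b = 0) → a = 0 ∨ b = 0

noncomputable abbrev extGrp (B : Type) [Ring B] (n : ℕ) (M N : ModuleCat B) : Type :=
  ((Ext ℤ (ModuleCat B) n).obj (Opposite.op M)).obj N

def RightTorsionFree (A : Type) [Ring A] (M : Type) [AddCommGroup M] [Module Aᵐᵒᵖ M] : Prop :=
  ∀ m : M, m ≠ 0 → ∀ a ∈ nonZeroDivisors A, (MulOpposite.op a) • m ≠ 0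

/-- A submodule is essential if it meets every nonzero submodule nontrivially. -/
def EssentialSubmodule {A : Type} [Ring A] {M : Type} [AddCommGroup M] [Module Aᵐᵒᵖ M]
    (L : Submodule Aᵐᵒᵖ M) : Prop :=
  ∀ N : Submodule Aᵐᵒᵖ M, N ≠ ⊥ → N ⊓ L ≠ ⊥

/-- A submodule is large if every nonzero element has a nonzero multiple in it. -/
def Submodule.IsLarge {R M : Type*} [Ring R] [AddCommGroup M] [Module R M]
    (L : Submodule R M) : Prop :=
  ∀ x : M, x ≠ 0 → ∃ r : R, r • x ≠ 0 ∧ r • x ∈ L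

lemma Submodule.IsLarge.mono {R M : Type*} [Ring R] [AddCommGroup M] [Module R M]
    {L L' : Submodule R M} (hL : L.IsLarge) (h : L ≤ L') : L'.IsLarge := fun x hx => by
  obtain ⟨r, hr, hrL⟩ := hL x hx
  exact ⟨r, hr, h hrL⟩

lemma Submodule.IsLarge.comap {R M N : Type*} [Ring R] [AddCommGroup M] [Module R M]
    [AddCommGroup N] [Module R N] {L : Submodule R N} (hL : L.IsLarge) (f : M →ₗ[R] N) :
    (L.comap f).IsLarge := fun x hx => by
  by_cases hfx : f x = 0
  · exact ⟨1, by simpa using hx, by simp [hfx]⟩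
  · obtain ⟨r, hr, hrL⟩ := hL (f x) hfx
    refine ⟨r, fun h => hr ?_, by simpa using hrL⟩
    rw [← map_smul, h, map_zero]

lemma Submodule.IsLarge.torsionOf_smul {R M : Type*} [Ring R] [AddCommGroup M] [Module R M]
    {x : M} (hx : (Ideal.torsionOf R M x).IsLarge) (b : R) :
    (Ideal.torsionOf R M (b • x)).IsLarge :=
  (hx.comap (LinearMap.toSpanSingleton R R b)).mono fun r hr => by
    simpa [mul_smul] using hr

lemma EssentialSubmodule.isLarge {A : Type} [Ring A] {M : Type} [AddCommGroup M]
    [Module Aᵐᵒᵖ M] {L : Submodule Aᵐᵒᵖ M} (hL : EssentialSubmodule L) : L.IsLarge :=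
  fun x hx => by
    have h := hL (Submodule.span Aᵐᵒᵖ {x}) (by simpa using hx)
    obtain ⟨y, hy, hy0⟩ := Submodule.exists_mem_ne_zero_of_ne_bot h
    obtain ⟨hyx, hyL⟩ := Submodule.mem_inf.1 hy
    obtain ⟨r, rfl⟩ := Submodule.mem_span_singleton.1 hyx
    exact ⟨r, hy0, hyL⟩

lemma IsPrimeRing.op {A : Type} [Ring A] (hA : IsPrimeRing A) : IsPrimeRing Aᵐᵒᵖ := by
  intro a b h
  have := hA b.unop a.unop fun x => by
    simpa [mul_assoc] using congrArg MulOpposite.unop (h (MulOpposite.op x))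
  simpa [or_comm] using this

section Noetherian

variable {B : Type} [Ring B] [IsNoetherianRing B]

lemma exists_maximal_of_nonempty {S : Set (Ideal B)} (hS : S.Nonempty) :
    ∃ I ∈ S, ∀ J ∈ S, I ≤ J → J ≤ I := by
  obtain ⟨I, hI, hmax⟩ := set_has_maximal_iff_noetherian.2 (inferInstance : IsNoetherian B B) S hS
  exact ⟨I, hI, fun J hJ hIJ => by_contra fun h => hmax J hJ (lt_of_le_not_ge hIJ h)⟩

/-- Some positive power of `z` has the same left annihilator as its square. -/
lemma exists_pow_mul_pow_eq_zero_imp (z : B) :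
    ∃ n ≠ 0, ∀ r : B, r * (z ^ n * z ^ n) = 0 → r * z ^ n = 0 := by
  obtain ⟨n, hn⟩ := monotone_stabilizes_iff_noetherian.2 (inferInstance : IsNoetherian B B)
    ⟨fun n => Ideal.torsionOf B B (z ^ n), fun m n hmn r hr => by
      obtain ⟨k, rfl⟩ := Nat.exists_eq_add_of_le hmn
      simp only [Ideal.mem_torsionOf_iff, smul_eq_mul] at hr ⊢
      rw [pow_add, ← mul_assoc, hr, zero_mul]⟩
  refine ⟨n + 1, n.succ_ne_zero, fun r hr => ?_⟩
  have h1 : Ideal.torsionOf B B (z ^ n) = Ideal.torsionOf B B (z ^ (n + 1)) :=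
    hn (n + 1) (by omega)
  have h2 : Ideal.torsionOf B B (z ^ n) = Ideal.torsionOf B B (z ^ (n + 1 + (n + 1))) :=
    hn (n + 1 + (n + 1)) (by omega)
  have h : r ∈ Ideal.torsionOf B B (z ^ (n + 1 + (n + 1))) := by
    simpa [Ideal.mem_torsionOf_iff, pow_add z (n + 1) (n + 1)] using hr
  have hr_succ : r ∈ Ideal.torsionOf B B (z ^ (n + 1)) := by
    rw [← h1, h2]
    exact h
  simpa [Ideal.mem_torsionOf_iff] using hr_succ

/-- A nil left ideal of a prime left noetherian ring vanishes. -/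
lemma IsPrimeRing.eq_bot_of_nil (hB : IsPrimeRing B) (I : Ideal B)
    (hI : ∀ x ∈ I, IsNilpotent x) : I = ⊥ := by
  by_contra hne
  obtain ⟨x, hx, hx0⟩ := Submodule.exists_mem_ne_zero_of_ne_bot hne
  obtain ⟨_, ⟨a, ⟨ha, ha0⟩, rfl⟩, hmax⟩ := exists_maximal_of_nonempty
    (S := Ideal.torsionOf B B '' {a | a ∈ I ∧ a ≠ 0}) ⟨_, x, ⟨hx, hx0⟩, rfl⟩
  refine (hB a a fun u => ?_).elim ha0 ha0
  have hex : ∃ k, a * (u * a) ^ k = 0 := by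
    obtain ⟨n, hn⟩ := hI (u * a) (I.mul_mem_left u ha)
    exact ⟨n, by rw [hn, mul_zero]⟩
  classical
  obtain ⟨k, hk⟩ : ∃ k, Nat.find hex = k + 1 :=
    Nat.exists_eq_succ_of_ne_zero fun h => ha0 (by simpa [h] using Nat.find_spec hex)
  have hk0 : a * (u * a) ^ k ≠ 0 := Nat.find_min hex (by omega)
  have hk1 : a * (u * a) ^ (k + 1) = 0 := hk ▸ Nat.find_spec hex
  have hmem : a * (u * a) ^ k ∈ I := by
    cases k with
    | zero => simpa using ha
    | succ k =>
      rw [pow_succ, ← mul_assoc, ← mul_assoc]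
      exact I.mul_mem_left _ ha
  have h := hmax _ ⟨_, ⟨hmem, hk0⟩, rfl⟩ fun r hr => by
    simp only [Ideal.mem_torsionOf_iff, smul_eq_mul] at hr ⊢
    rw [← mul_assoc, hr, zero_mul]
  have hau : a * u ∈ Ideal.torsionOf B B (a * (u * a) ^ k) := by
    simp only [Ideal.mem_torsionOf_iff, smul_eq_mul]
    rw [← hk1, pow_succ']
    simp only [mul_assoc]
  simpa [Ideal.mem_torsionOf_iff] using h hau

/-- A nonzero left ideal contains a nonzero element with the same left annihilator as its
square. -/
lemma IsPrimeRing.exists_mul_self_eq_zero_imp (hB : IsPrimeRing B) {I : Ideal B} (hI : I ≠ ⊥) :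
    ∃ a ∈ I, a ≠ 0 ∧ ∀ r : B, r * (a * a) = 0 → r * a = 0 := by
  have : ∃ u ∈ I, ¬ IsNilpotent u := by
    by_contra! h
    exact hI (hB.eq_bot_of_nil I h)
  obtain ⟨u, hu, hnil⟩ := this
  obtain ⟨n, hn, h⟩ := exists_pow_mul_pow_eq_zero_imp u
  exact ⟨u ^ n, I.pow_mem_of_mem hu n (Nat.pos_of_ne_zero hn), fun h0 => hnil ⟨n, h0⟩, h⟩

/-- A prime left noetherian ring is left nonsingular. -/
lemma IsPrimeRing.eq_zero_of_isLarge_torsionOf (hB : IsPrimeRing B) {z : B}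
    (hz : (Ideal.torsionOf B B z).IsLarge) : z = 0 := by
  have hbot : Ideal.span {z} = ⊥ := hB.eq_bot_of_nil _ fun x hx => by
    obtain ⟨b, rfl⟩ := Ideal.mem_span_singleton'.1 hx
    have hbz : (Ideal.torsionOf B B (b * z)).IsLarge := hz.torsionOf_smul b
    obtain ⟨n, hn, h⟩ := exists_pow_mul_pow_eq_zero_imp (b * z)
    obtain ⟨m, rfl⟩ := Nat.exists_eq_succ_of_ne_zero hn
    refine ⟨m + 1, by_contra fun h0 => ?_⟩
    obtain ⟨r, hr0, hr⟩ := hbz _ h0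
    simp only [Ideal.mem_torsionOf_iff, smul_eq_mul] at hr hr0
    refine hr0 (h r ?_)
    rw [← mul_assoc, Nat.succ_eq_add_one, pow_succ' (b * z) m, ← mul_assoc _ (b * z),
      ← pow_succ', hr, zero_mul]
  simpa using hbot

/-- In a left noetherian ring, `B c` is large when `c` has no left annihilator. -/
lemma isLarge_range_of_mul_eq_zero_imp {c : B} (hc : ∀ r : B, r * c = 0 → r = 0) :
    (LinearMap.range (LinearMap.toSpanSingleton B B c)).IsLarge := by
  intro x hx
  by_contra! h
  have hx' : x ∈ Submodule.span B {x} := Submodule.mem_span_singleton_self x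
  have hdisj : Disjoint (LinearMap.range (LinearMap.toSpanSingleton B B c))
      (LinearMap.range (Submodule.span B {x}).subtype) := by
    rw [Submodule.range_subtype, Submodule.disjoint_def]
    intro y hy hyx
    obtain ⟨r, rfl⟩ := Submodule.mem_span_singleton.1 hyx
    exact by_contra fun h0 => h r h0 hy
  have hinj : Function.Injective
      ((LinearMap.toSpanSingleton B B c).coprod (Submodule.span B {x}).subtype) := by
    rw [← LinearMap.ker_eq_bot, LinearMap.ker_coprod_of_disjoint_range _ _ hdisj,
      Submodule.ker_subtype, LinearMap.ker_eq_bot'.2 (fun r hr => hc r (by simpa using hr)),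
      Submodule.prod_bot]
  have e := IsNoetherian.equivPUnitOfProdInjective _ hinj
  have : (⟨x, hx'⟩ : Submodule.span B {x}) = 0 := e.injective (Subsingleton.elim _ _)
  exact hx (congrArg Subtype.val this)

/-- Goldie: a large left ideal of a prime left noetherian ring contains a regular element. -/
lemma IsPrimeRing.exists_mem_nonZeroDivisors (hB : IsPrimeRing B) {I : Ideal B}
    (hI : I.IsLarge) : ∃ c ∈ I, c ∈ nonZeroDivisors B := by
  obtain ⟨J, ⟨c, hcI, hc, hJ⟩, hmax⟩ := exists_maximal_of_nonempty
    (S := {J : Ideal B | ∃ c ∈ I, (∀ r : B, r * (c * c) = 0 → r * c = 0) ∧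
      ∀ r ∈ J, r * c = 0 → r = 0}) ⟨⊥, 0, I.zero_mem, by simp, by simp⟩
  have hbot : Ideal.torsionOf B B c ⊓ I = ⊥ := by
    by_contra hne
    obtain ⟨a, ha, ha0, haa⟩ := hB.exists_mul_self_eq_zero_imp hne
    obtain ⟨hac, haI⟩ := Submodule.mem_inf.1 ha
    replace hac : a * c = 0 := by simpa [Ideal.mem_torsionOf_iff] using hac
    have key : ∀ r : B, r * (c + a) = 0 → r * c = 0 ∧ r * a = 0 := fun r hr => by
      have h1 : r * c = 0 := hc r (by
        have := congrArg (· * c) hr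
        simpa [mul_add, add_mul, mul_assoc, hac] using this)
      exact ⟨h1, by simpa [mul_add, h1] using hr⟩
    have hle := hmax (J ⊔ Ideal.span {a}) ⟨c + a, I.add_mem hcI haI, fun r hr => by
        rw [← mul_assoc] at hr
        obtain ⟨h1, h2⟩ := key _ hr
        have hrc : r * c = 0 := hc r (by
          simpa [mul_add, add_mul, mul_assoc, hac] using h1)
        have hra : r * a = 0 := haa r (by
          simpa [mul_add, add_mul, hrc, mul_assoc] using h2)
        rw [mul_add, hrc, hra, add_zero], fun r hr hrz => by
        obtain ⟨h1, h2⟩ := key _ hrz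
        obtain ⟨j, hj, s, hs, rfl⟩ := Submodule.mem_sup.1 hr
        obtain ⟨b, rfl⟩ := Ideal.mem_span_singleton'.1 hs
        have hj0 : j = 0 := hJ j hj (by simpa [add_mul, mul_assoc, hac] using h1)
        subst hj0
        rw [zero_add] at h2 ⊢
        exact haa b (by simpa [mul_assoc] using h2)⟩ le_sup_left
    exact ha0 (hJ a (hle (Ideal.mem_sup_right (Ideal.mem_span_singleton_self a))) hac)
  have hleft : ∀ r : B, r * c = 0 → r = 0 := fun r hr => by
    by_contra hr0
    obtain ⟨s, hs0, hs⟩ := hI r hr0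
    refine hs0 ((Submodule.mem_bot B).1 (hbot ▸ Submodule.mem_inf.2 ⟨?_, hs⟩))
    simp [Ideal.mem_torsionOf_iff, mul_assoc, hr]
  refine ⟨c, hcI, mem_nonZeroDivisors_iff.2 ⟨fun d hd => ?_, hleft⟩⟩
  refine hB.eq_zero_of_isLarge_torsionOf ((isLarge_range_of_mul_eq_zero_imp hleft).mono ?_)
  rintro _ ⟨r, rfl⟩
  simp [Ideal.mem_torsionOf_iff, mul_assoc, hd]

end Noetherian

lemma rightTorsionFree_of_isLarge_range {A : Type} [Ring A] (hA : IsPrimeRing A)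
    [IsNoetherianRing Aᵐᵒᵖ] {X Y : Type} [AddCommGroup X] [Module Aᵐᵒᵖ X] [AddCommGroup Y]
    [Module Aᵐᵒᵖ Y] (φ : X →ₗ[Aᵐᵒᵖ] Y) (hφ : Function.Injective φ)
    (hlarge : (LinearMap.range φ).IsLarge) (hX : RightTorsionFree A X) :
    RightTorsionFree A Y := by
  intro y hy a ha hay
  obtain ⟨b, hb0, x, hx⟩ := hlarge y hy
  have hlarge_y : (Ideal.torsionOf Aᵐᵒᵖ Y y).IsLarge :=
    (isLarge_range_of_mul_eq_zero_imp (c := MulOpposite.op a) fun r hr =>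
      MulOpposite.unop_injective ((mem_nonZeroDivisors_iff.1 ha).1 r.unop
        (by simpa using congrArg MulOpposite.unop hr))).mono (by
      rintro _ ⟨r, rfl⟩
      simp [Ideal.mem_torsionOf_iff, mul_smul, hay])
  obtain ⟨c, hc, hcreg⟩ := hA.op.exists_mem_nonZeroDivisors (hlarge_y.torsionOf_smul b)
  have hcreg' : c.unop ∈ nonZeroDivisors A := by
    rw [mem_nonZeroDivisors_iff] at hcreg ⊢
    exact ⟨fun x hx => MulOpposite.op_injective
        (hcreg.2 (MulOpposite.op x) (MulOpposite.unop_injective (by simpa using hx))),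
      fun x hx => MulOpposite.op_injective
        (hcreg.1 (MulOpposite.op x) (MulOpposite.unop_injective (by simpa using hx)))⟩
  refine hX x (fun h => hb0 (by rw [← hx, h, map_zero])) c.unop hcreg' (hφ ?_)
  rw [map_smul, hx, map_zero]
  simpa [Ideal.mem_torsionOf_iff] using hc

/-- If `Ext^{n+1}(N, Z)` vanishes, cocycles on a projective resolution of `N` are coboundaries. -/
lemma exists_comp_eq_of_subsingleton_extGrp {B : Type} [Ring B] {N Z : ModuleCat.{0} B} {n : ℕ}
    (h : Subsingleton (extGrp B (n + 1) N Z)) (P : ProjectiveResolution N)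
    (u : P.complex.X (n + 1) ⟶ Z) (hu : P.complex.d (n + 2) (n + 1) ≫ u = 0) :
    ∃ v : P.complex.X n ⟶ Z, P.complex.d (n + 1) n ≫ v = u := by
  have hz : Limits.IsZero ((P.complex.linearYonedaObj ℤ Z).homology (n + 1)) :=
    (ModuleCat.isZero_of_subsingleton _).of_iso (P.isoExt (R := ℤ) (n + 1) Z).symm
  rw [← HomologicalComplex.exactAt_iff_isZero_homology,
    HomologicalComplex.exactAt_iff' _ n (n + 1) (n + 2) (by simp) (by simp),
    ShortComplex.moduleCat_exact_iff] at hz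
  obtain ⟨v, hv⟩ := hz u hu
  exact ⟨v, hv⟩

/-- If `Ext²(M/L, Z)` vanishes, every extension of `L` by `Z` is the restriction of an extension
of `M` by `Z`. -/
lemma exists_extension_of_subsingleton_extGrp {B : Type} [Ring B] {M Z X : Type}
    [AddCommGroup M] [Module B M] [AddCommGroup Z] [Module B Z] [AddCommGroup X] [Module B X]
    (L : Submodule B M)
    (h : Subsingleton (extGrp B 2 (ModuleCat.of B (M ⧸ L)) (ModuleCat.of B Z)))
    (i : Z →ₗ[B] X) (p : X →ₗ[B] L) (hi : Function.Injective i) (hp : Function.Surjective p)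
    (hip : Function.Exact i p) :
    ∃ (Y : ModuleCat.{0} B) (j : Z →ₗ[B] Y) (q : Y →ₗ[B] M) (φ : X →ₗ[B] Y),
      Function.Injective j ∧ Function.Surjective q ∧ Function.Exact j q ∧
      Function.Injective φ ∧ φ ∘ₗ i = j ∧ q ∘ₗ φ = L.subtype ∘ₗ p := by
  obtain ⟨P⟩ := HasProjectiveResolution.out (Z := ModuleCat.of B (M ⧸ L))
  have hproj : ∀ n, Module.Projective B (P.complex.X n) := fun n =>
    (IsProjective.iff_projective _).2 (P.projective n)
  let d₁ : P.complex.X 1 →ₗ[B] P.complex.X 0 := (P.complex.d 1 0).hom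
  let d₂ : P.complex.X 2 →ₗ[B] P.complex.X 1 := (P.complex.d 2 1).hom
  let d₃ : P.complex.X 3 →ₗ[B] P.complex.X 2 := (P.complex.d 3 2).hom
  let π : P.complex.X 0 →ₗ[B] M ⧸ L := (P.π.f 0).hom
  have hπ : Function.Surjective π := (ModuleCat.epi_iff_surjective _).1 inferInstance
  have hex₀ : Function.Exact d₁ π :=
    (ShortComplex.ShortExact.moduleCat_exact_iff_function_exact _).1 P.exact₀
  have hex₁ : Function.Exact d₂ d₁ :=
    (ShortComplex.ShortExact.moduleCat_exact_iff_function_exact _).1 (P.exact_succ 0)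
  have hex₂ : Function.Exact d₃ d₂ :=
    (ShortComplex.ShortExact.moduleCat_exact_iff_function_exact _).1 (P.exact_succ 1)
  obtain ⟨s, hs⟩ := Module.projective_lifting_property L.mkQ π L.mkQ_surjective
  have hs' : ∀ f, L.mkQ (s f) = π f := fun f => LinearMap.congr_fun hs f
  have hsd : ∀ z, s (d₁ z) ∈ L := fun z => by
    rw [← Submodule.Quotient.mk_eq_zero, ← Submodule.mkQ_apply, hs', hex₀.apply_apply_eq_zero]
  obtain ⟨g, hg⟩ := Module.projective_lifting_property p ((s ∘ₗ d₁).codRestrict L hsd) hp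
  have hg' : ∀ z, (p (g z) : M) = s (d₁ z) := fun z =>
    congrArg Subtype.val (LinearMap.congr_fun hg z)
  have hgd : ∀ w, g (d₂ w) ∈ LinearMap.range i := fun w =>
    (hip _).1 (Subtype.ext (by simp [hg', hex₁.apply_apply_eq_zero]))
  let e := LinearEquiv.ofInjective i hi
  have he : ∀ x, i (e.symm x) = x := fun x =>
    congrArg Subtype.val (e.apply_symm_apply x)
  let u : P.complex.X 2 →ₗ[B] Z := e.symm ∘ₗ (g ∘ₗ d₂).codRestrict _ hgd
  have hu : ∀ w, i (u w) = g (d₂ w) := fun w => he _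
  obtain ⟨v, hv⟩ := exists_comp_eq_of_subsingleton_extGrp (n := 1) h P (ModuleCat.ofHom u) (by
    ext w
    refine hi (((hu (d₃ w)).trans ?_).trans (map_zero i).symm)
    rw [hex₂.apply_apply_eq_zero, map_zero])
  have hv' : ∀ w, v.hom (d₂ w) = u w := fun w =>
    LinearMap.congr_fun (congrArg ModuleCat.Hom.hom hv) w
  let g' : P.complex.X 1 →ₗ[B] X := g - i ∘ₗ v.hom
  have hg'd : ∀ w, g' (d₂ w) = 0 := fun w => by
    simp only [g', LinearMap.sub_apply, LinearMap.comp_apply, hv', hu, sub_self]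
  have hpg' : ∀ z, (p (g' z) : M) = s (d₁ z) := fun z => by
    simp only [g', LinearMap.sub_apply, LinearMap.comp_apply, map_sub, hip.apply_apply_eq_zero,
      sub_zero, hg']
  let W := LinearMap.range (g'.prod (-d₁))
  let q : ((X × P.complex.X 0) ⧸ W) →ₗ[B] M := W.liftQ ((L.subtype ∘ₗ p).coprod s) (by
    rintro _ ⟨z, rfl⟩
    simp [hpg'])
  let φ : X →ₗ[B] ((X × P.complex.X 0) ⧸ W) := W.mkQ ∘ₗ LinearMap.inl B X (P.complex.X 0)
  have hqφ : ∀ x, q (φ x) = p x := fun x => by simp [q, φ]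
  have hφ : Function.Injective φ := by
    rw [injective_iff_map_eq_zero]
    intro x hx
    obtain ⟨z, hz⟩ := (Submodule.Quotient.mk_eq_zero W).1 hx
    obtain ⟨hz₁, hz₂⟩ := Prod.ext_iff.1 hz
    obtain ⟨w, rfl⟩ := (hex₁ z).1 (neg_eq_zero.1 hz₂)
    exact hz₁.symm.trans (hg'd w)
  refine ⟨ModuleCat.of B ((X × P.complex.X 0) ⧸ W), φ ∘ₗ i, q, φ, hφ.comp hi, fun m => ?_,
    fun y => ⟨fun hy => ?_, ?_⟩, hφ, rfl, LinearMap.ext hqφ⟩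
  · obtain ⟨f, hf⟩ := hπ (L.mkQ m)
    obtain ⟨x, hx⟩ := hp ⟨m - s f, (Submodule.Quotient.mk_eq_zero L).1 (by
      rw [← Submodule.mkQ_apply, map_sub, hs', hf, sub_self])⟩
    exact ⟨W.mkQ (x, f), by simp [q, hx]⟩
  · obtain ⟨⟨x, f⟩, rfl⟩ := W.mkQ_surjective y
    have hy' : (p x : M) + s f = 0 := by simpa [q] using hy
    obtain ⟨z, rfl⟩ := (hex₀ f).1 (by
      rw [← hs', eq_neg_of_add_eq_zero_right hy']
      simp)
    obtain ⟨t, ht⟩ := (hip (x + g' z)).1 (Subtype.ext (by simpa [hpg'] using hy'))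
    refine ⟨t, ?_⟩
    refine (Submodule.Quotient.eq W).2 ⟨z, ?_⟩
    simp [ht]
  · rintro ⟨t, rfl⟩
    exact (hqφ (i t)).trans (by simp [hip.apply_apply_eq_zero])

theorem stmt_2 (A : Type) [Ring A]
    (hprime : IsPrimeRing A)
    (hnoeth : IsNoetherianRing Aᵐᵒᵖ)
    (M : Type) [AddCommGroup M] [Module Aᵐᵒᵖ M] [Module.Finite Aᵐᵒᵖ M]
    (L : Submodule Aᵐᵒᵖ M) (hess : EssentialSubmodule L)
    (hext2 : Subsingleton
      (extGrp Aᵐᵒᵖ 2 (ModuleCat.of Aᵐᵒᵖ (M ⧸ L)) (ModuleCat.of Aᵐᵒᵖ Aᵐᵒᵖ)))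
    -- an extension `0 → A → X → L → 0` with `X` torsionfree:
    (X : Type) [AddCommGroup X] [Module Aᵐᵒᵖ X]
    (i : Aᵐᵒᵖ →ₗ[Aᵐᵒᵖ] X) (p : X →ₗ[Aᵐᵒᵖ] L)
    (hi : Function.Injective i) (hp : Function.Surjective p) (hip : Function.Exact i p)
    (hXtf : RightTorsionFree A X) :
    -- the extension lifts to an extension `0 → A → Y → M → 0` ...
    (∃ (Y : ModuleCat Aᵐᵒᵖ) (j : Aᵐᵒᵖ →ₗ[Aᵐᵒᵖ] Y) (q : Y →ₗ[Aᵐᵒᵖ] M) (φ : X →ₗ[Aᵐᵒᵖ] Y),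
      Function.Injective j ∧ Function.Surjective q ∧ Function.Exact j q ∧
      Function.Injective φ ∧ φ ∘ₗ i = j ∧ q ∘ₗ φ = L.subtype ∘ₗ p) ∧
    -- ... and every such `Y` is torsionfree:
    (∀ (Y : ModuleCat Aᵐᵒᵖ) (j : Aᵐᵒᵖ →ₗ[Aᵐᵒᵖ] Y) (q : Y →ₗ[Aᵐᵒᵖ] M) (φ : X →ₗ[Aᵐᵒᵖ] Y),
      Function.Injective j → Function.Surjective q → Function.Exact j q →
      φ ∘ₗ i = j → q ∘ₗ φ = L.subtype ∘ₗ p →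
      RightTorsionFree A Y) := by
  have := hnoeth
  constructor
  · obtain ⟨Y, j, q, φ, hj, hq, hjq, hφ, rfl, hqφ⟩ :=
      exists_extension_of_subsingleton_extGrp L hext2 i p hi hp hip
    let e : ULift Y ≃ₗ[Aᵐᵒᵖ] Y := ULift.moduleEquiv
    refine ⟨ModuleCat.of Aᵐᵒᵖ (ULift Y), e.symm.toLinearMap ∘ₗ φ ∘ₗ i, q ∘ₗ e.toLinearMap,
      e.symm.toLinearMap ∘ₗ φ,
      e.symm.injective.comp hj, hq.comp e.surjective, fun y => ?_, e.symm.injective.comp hφ,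
      rfl, LinearMap.ext fun x => LinearMap.congr_fun hqφ x⟩
    refine (hjq (e y)).trans (exists_congr fun t => ?_)
    exact e.symm_apply_eq.symm
  intro Y j q φ hj hq hjq hφi hqφ
  have hφi' : ∀ t, φ (i t) = j t := LinearMap.congr_fun hφi
  have hqφ' : ∀ x, q (φ x) = p x := LinearMap.congr_fun hqφ
  refine rightTorsionFree_of_isLarge_range hprime φ ?_ ((hess.isLarge.comap q).mono ?_) hXtf
  · rw [injective_iff_map_eq_zero]
    intro x hx
    obtain ⟨t, rfl⟩ := (hip x).1 (Subtype.ext (by rw [← hqφ', hx, map_zero]; rfl))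
    rw [hj ((hφi' t).symm.trans (hx.trans (map_zero j).symm)), map_zero]
  · intro y hy
    obtain ⟨x, hx⟩ := hp ⟨q y, hy⟩
    obtain ⟨t, ht⟩ := (hjq (y - φ x)).1 (by rw [map_sub, hqφ', hx, sub_self])
    exact ⟨i t + x, by rw [map_add, hφi', ht, sub_add_cancel]⟩
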